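/- arXiv:1910.11962 — 4 statements merged into one kernel-verified Lean document; each statement's English description precedes it below -/
import Mathlib

section
/- Let X be a real Banach space, let ε > 0 and δ > 0. Suppose C and C₁ are closed, bounded, convex subsets of X with C₁ properly contained in C, and suppose C = cl(co(C₁ ∪ C₂)) where C₂ is a convex subset of C with diam(C₂) < ε. Then there exists a slice S of C with S ⊆ C₂ + B_δ(0). In particular, C is ε-dentable. -/
open Set Metric Bornology Pointwise

variable {X : Type*} [NormedAddCommGroup X] [NormedSpace ℝ X]

/-- The slice `S(f, A, δ) = {a ∈ A : f a > sup f(A) - δ}`. -/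
noncomputable def sliceSet (f : X →L[ℝ] ℝ) (A : Set X) (δ : ℝ) : Set X :=
  {a ∈ A | sSup (f '' A) - δ < f a}

/-- `S` is a slice of `A`: `S = S(f, A, δ)` for some `f` in the closed unit ball
of the dual and some `δ > 0`. -/
def IsSlice (A S : Set X) : Prop :=
  ∃ (f : X →L[ℝ] ℝ) (δ : ℝ), ‖f‖ ≤ 1 ∧ 0 < δ ∧ S = sliceSet f A δ

/-- A bounded set `A` is `ε`-dentable if it has a slice of diameter at most `ε`. -/
def EpsDentable (ε : ℝ) (A : Set X) : Prop :=
  ∃ S, IsSlice A S ∧ Metric.diam S ≤ ε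

theorem exists_contractive_separation {s : Set X} {x : X} (hs : Convex ℝ s) (hcl : IsClosed s)
    (hx : x ∉ s) : ∃ (f : X →L[ℝ] ℝ) (u : ℝ), ‖f‖ ≤ 1 ∧ (∀ a ∈ s, f a < u) ∧ u < f x := by
  obtain ⟨f, u, hfs, hfx⟩ := geometric_hahn_banach_closed_point hs hcl hx
  have hpos : 0 < (‖f‖ + 1)⁻¹ := by positivity
  refine ⟨(‖f‖ + 1)⁻¹ • f, (‖f‖ + 1)⁻¹ * u, ?_, fun a ha => ?_, ?_⟩
  · rw [norm_smul, Real.norm_of_nonneg hpos.le, inv_mul_le_iff₀ (by positivity)]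
    linarith
  · simpa using mul_lt_mul_of_pos_left (hfs a ha) hpos
  · simpa using mul_lt_mul_of_pos_left hfx hpos

/-- If a bounded set `C` is the closed convex hull of a closed convex proper subset `C₁` and a
convex set `C₂`, then `C` has slices contained in arbitrarily small neighbourhoods of `C₂`. -/
theorem exists_isSlice_subset_add_ball {δ : ℝ} (hδ : 0 < δ) {C C₁ C₂ : Set X}
    (hCb : IsBounded C) (hC₁cl : IsClosed C₁) (hC₁cv : Convex ℝ C₁) (hC₁C : C₁ ⊂ C)
    (hC₂cv : Convex ℝ C₂) (hCeq : C = closure (convexHull ℝ (C₁ ∪ C₂))) :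
    ∃ S, IsSlice C S ∧ S ⊆ C₂ + Metric.ball (0 : X) δ := by
  rcases C₁.eq_empty_or_nonempty with rfl | hne₁
  · refine ⟨_, ⟨0, 1, by simp, one_pos, rfl⟩, fun y hy => ?_⟩
    have hyC : y ∈ C := hy.1
    rw [hCeq, empty_union, hC₂cv.convexHull_eq] at hyC
    obtain ⟨z, hz, hyz⟩ := Metric.mem_closure_iff.1 hyC δ hδ
    exact ⟨z, hz, y - z, by simpa [dist_eq_norm] using hyz, by simp⟩
  rcases C₂.eq_empty_or_nonempty with rfl | hne₂
  · rw [union_empty, hC₁cv.convexHull_eq, hC₁cl.closure_eq] at hCeq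
    exact absurd hCeq.symm hC₁C.ne
  have hC₂C : C₂ ⊆ C := fun y hy =>
    hCeq ▸ subset_closure (subset_convexHull ℝ _ (Or.inr hy))
  obtain ⟨x, hxC, hx⟩ := exists_of_ssubset hC₁C
  obtain ⟨f, u, hf, hfs, hfx⟩ := exists_contractive_separation hC₁cv hC₁cl hx
  obtain ⟨D, hD, hCD⟩ : ∃ D : ℝ, 0 < D ∧ ∀ a ∈ C, ∀ b ∈ C, dist a b ≤ D :=
    ⟨Metric.diam C + 1, by positivity, fun a ha b hb =>
      (Metric.dist_le_diam_of_mem hCb ha hb).trans (by linarith)⟩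
  have hbdd : BddAbove (f '' C) := (f.lipschitz.isBounded_image hCb).bddAbove
  set M := sSup (f '' C) with hM
  have hle : ∀ c ∈ C, f c ≤ M := fun c hc => le_csSup hbdd (mem_image_of_mem f hc)
  have huM : 0 < M - u := by linarith [hle x hxC]
  refine ⟨_, ⟨f, δ / 2 * (M - u) / D, hf, by positivity, rfl⟩, ?_⟩
  rintro y ⟨hyC, hy⟩
  rw [← hM] at hy
  rw [hCeq] at hyC
  obtain ⟨z, ⟨hzf, hzy⟩, hz⟩ := mem_closure_iff.1 hyC
    ({w | M - δ / 2 * (M - u) / D < f w} ∩ Metric.ball y (δ / 2))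
    ((isOpen_lt continuous_const f.continuous).inter Metric.isOpen_ball)
    ⟨hy, Metric.mem_ball_self (by positivity)⟩
  rw [hC₁cv.convexHull_union hC₂cv hne₁ hne₂, mem_convexJoin] at hz
  obtain ⟨a, ha, b, hb, s, t, hs, ht, hst, rfl⟩ := hz
  have hfa := hfs a ha
  have hfb := hle b (hC₂C hb)
  have hsu : s * (M - u) < δ / 2 * (M - u) / D := by
    have h : M - δ / 2 * (M - u) / D < s * f a + t * f b := by simpa using hzf
    obtain rfl : t = 1 - s := by linarith
    nlinarith [mul_le_mul_of_nonneg_left hfa.le hs, mul_le_mul_of_nonneg_left hfb ht]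
  have hsD : s * D < δ / 2 := by
    rw [lt_div_iff₀ hD] at hsu
    nlinarith
  have hzb : dist (s • a + t • b) b ≤ s * D := by
    obtain rfl : t = 1 - s := by linarith
    have : s • a + (1 - s) • b - b = s • (a - b) := by module
    rw [dist_eq_norm, this, norm_smul, Real.norm_of_nonneg hs, ← dist_eq_norm]
    exact mul_le_mul_of_nonneg_left (hCD a (hC₁C.subset ha) b (hC₂C hb)) hs
  refine ⟨b, hb, y - b, ?_, by simp⟩
  rw [mem_ball_zero_iff, ← dist_eq_norm]
  have := dist_triangle_left y b (s • a + t • b)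
  rw [Metric.mem_ball] at hzy
  linarith

theorem diam_le_of_subset_add_ball {E : Type*} [SeminormedAddCommGroup E] {S A : Set E} {r : ℝ}
    (hA : IsBounded A) (hr : 0 ≤ r) (h : S ⊆ A + Metric.ball (0 : E) r) :
    Metric.diam S ≤ Metric.diam A + 2 * r := by
  rw [add_ball_zero] at h
  exact (Metric.diam_mono h hA.thickening).trans (Metric.diam_thickening_le A hr)

theorem statement0 [CompleteSpace X] (ε δ : ℝ) (hε : 0 < ε) (hδ : 0 < δ)
    (C C₁ C₂ : Set X)
    (hCcl : IsClosed C) (hCb : IsBounded C) (hCcv : Convex ℝ C)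
    (hC₁cl : IsClosed C₁) (hC₁b : IsBounded C₁) (hC₁cv : Convex ℝ C₁)
    (hC₁C : C₁ ⊂ C)
    (hC₂cv : Convex ℝ C₂) (hC₂C : C₂ ⊆ C) (hC₂d : Metric.diam C₂ < ε)
    (hCeq : C = closure (convexHull ℝ (C₁ ∪ C₂))) :
    (∃ S, IsSlice C S ∧ S ⊆ C₂ + Metric.ball (0 : X) δ) ∧ EpsDentable ε C := by
  refine ⟨exists_isSlice_subset_add_ball hδ hCb hC₁cl hC₁cv hC₁C hC₂cv hCeq, ?_⟩
  obtain ⟨S, hS, hsub⟩ := exists_isSlice_subset_add_ball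
    (δ := (ε - Metric.diam C₂) / 2) (by linarith) hCb hC₁cl hC₁cv hC₁C hC₂cv hCeq
  refine ⟨S, hS, ?_⟩
  linarith [diam_le_of_subset_add_ball (hCb.subset hC₂C) (by linarith) hsub]
end

section
/- Let X be a real Banach space, let A ⊆ X be bounded and nonempty, and let ε > 0. If A is non-ε-dentable, then for every δ < ε/2 and every finite collection a₁, a₂, …, aₙ ∈ A, one has cl(co(A)) = cl(co(A \ (B_δ(a₁) ∪ B_δ(a₂) ∪ ⋯ ∪ B_δ(aₙ)))). -/
open Set Metric Bornology Pointwise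

variable {X : Type*} [NormedAddCommGroup X] [NormedSpace ℝ X]

/-- Strict separation of a point from a closed convex set by a functional of norm at most one. -/
theorem exists_norm_le_one_separating {C : Set X} (hC : Convex ℝ C) (hCc : IsClosed C) {x : X}
    (hx : x ∉ C) : ∃ (f : X →L[ℝ] ℝ) (u : ℝ), ‖f‖ ≤ 1 ∧ (∀ y ∈ C, f y < u) ∧ u < f x := by
  obtain ⟨f, u, hfu, hux⟩ := geometric_hahn_banach_closed_point hC hCc hx
  have hpos : 0 < (1 + ‖f‖)⁻¹ := by positivity
  refine ⟨(1 + ‖f‖)⁻¹ • f, (1 + ‖f‖)⁻¹ * u, ?_, fun y hy => ?_, ?_⟩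
  · rw [norm_smul, Real.norm_of_nonneg hpos.le, inv_mul_le_iff₀ (by positivity)]
    linarith
  · exact mul_lt_mul_of_pos_left (hfu y hy) hpos
  · exact mul_lt_mul_of_pos_left hux hpos

/-- If `A` is not `ε`-dentable and lies in the closed convex hull of `B ⊆ A`, then it still lies
in the closed convex hull after removing from `B` a ball of radius less than `ε / 2`. -/
theorem subset_closure_convexHull_diff_ball {A B : Set X} (hAb : IsBounded A) {ε : ℝ}
    (hε : 0 < ε) (hAnd : ¬ EpsDentable ε A) {δ : ℝ} (hδ : δ < ε / 2) (c : X) (hBA : B ⊆ A)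
    (hAB : A ⊆ closure (convexHull ℝ B)) :
    A ⊆ closure (convexHull ℝ (B \ ball c δ)) := by
  intro x hxA
  by_contra hx
  obtain ⟨f, u, hf, hfu, hux⟩ :=
    exists_norm_le_one_separating (convex_convexHull ℝ _).closure isClosed_closure hx
  set s := sSup (f '' A)
  have hle : ∀ y ∈ A, f y ≤ s := fun y hy =>
    le_csSup (f.lipschitz.isBounded_image hAb).bddAbove (mem_image_of_mem f hy)
  have hus : 0 < s - u := sub_pos.2 (hux.trans_le (hle x hxA))
  obtain ⟨M, hM⟩ := hAb.subset_closedBall c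
  set k := (|M| + |δ|) / (s - u)
  have hk0 : 0 ≤ k := by positivity
  have hconv : ConvexOn ℝ univ fun z => dist z c + k * f z :=
    (convexOn_univ_dist c).add ((f.toLinearMap.convexOn convex_univ).smul hk0)
  have hB : B ⊆ {z | dist z c + k * f z ≤ δ + k * s} := by
    intro z hz
    by_cases hzc : z ∈ ball c δ
    · exact add_le_add (mem_ball.1 hzc).le (mul_le_mul_of_nonneg_left (hle z (hBA hz)) hk0)
    · have hzu := hfu z (subset_closure (subset_convexHull ℝ _ ⟨hz, hzc⟩))
      have hzM : dist z c ≤ M := hM (hBA hz)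
      have hks : k * (s - u) = |M| + |δ| := div_mul_cancel₀ _ hus.ne'
      have := mul_le_mul_of_nonneg_left hzu.le hk0
      have := le_abs_self M
      have := neg_abs_le δ
      rw [mem_ofPred_eq]
      linarith
  have hA : A ⊆ {z | dist z c + k * f z ≤ δ + k * s} := by
    refine hAB.trans (closure_minimal (convexHull_min hB ?_) ?_)
    · simpa using hconv.convex_le (δ + k * s)
    · exact isClosed_le (by fun_prop) continuous_const
  refine hAnd ⟨_, ⟨f, (ε / 2 - δ) / (k + 1), hf, div_pos (by linarith) (by linarith), rfl⟩, ?_⟩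
  have hsub : sliceSet f A ((ε / 2 - δ) / (k + 1)) ⊆ closedBall c (ε / 2) := by
    rintro z ⟨hzA, hz⟩
    have hzT : dist z c + k * f z ≤ δ + k * s := hA hzA
    have hη : (ε / 2 - δ) / (k + 1) * (k + 1) = ε / 2 - δ := div_mul_cancel₀ _ (by positivity)
    have hη0 : 0 < (ε / 2 - δ) / (k + 1) := div_pos (by linarith) (by linarith)
    have := mul_le_mul_of_nonneg_left hz.le hk0
    rw [mem_closedBall]
    linarith
  calc diam (sliceSet f A ((ε / 2 - δ) / (k + 1))) ≤ diam (closedBall c (ε / 2)) :=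
        diam_mono hsub isBounded_closedBall
    _ ≤ 2 * (ε / 2) := diam_closedBall (by positivity)
    _ = ε := by ring

theorem statement3 [CompleteSpace X] (A : Set X) (hA : A.Nonempty)
    (hAb : IsBounded A) (ε : ℝ) (hε : 0 < ε) (hAnd : ¬ EpsDentable ε A)
    (δ : ℝ) (hδ : δ < ε / 2) (n : ℕ) (a : Fin n → X) (ha : ∀ i, a i ∈ A) :
    closure (convexHull ℝ A) =
      closure (convexHull ℝ (A \ ⋃ i, Metric.ball (a i) δ)) := by
  have key : ∀ t : Finset (Fin n),
      A ⊆ closure (convexHull ℝ (A \ ⋃ i ∈ t, ball (a i) δ)) := by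
    intro t
    induction t using Finset.induction_on with
    | empty => simpa using (subset_convexHull ℝ A).trans subset_closure
    | insert i t _ ih =>
      rw [Finset.set_biUnion_insert, union_comm, ← sdiff_sdiff]
      exact subset_closure_convexHull_diff_ball hAb hε hAnd hδ (a i) sdiff_subset ih
  refine (closure_minimal (convexHull_min ?_ (convex_convexHull ℝ _).closure)
    isClosed_closure).antisymm (closure_mono (convexHull_mono sdiff_subset))
  simpa using key Finset.univ
end

section
/- Let X be a real Banach space, let C ⊆ B_X (the closed unit ball of X) be closed and convex, let γ ∈ (0,1), and let S = S(f,C,δ) be a slice of C with γ-shallow parallel S^γ = S(f,C,γδ/2). Then S^γ ⊆ S. Moreover, for any E ⊆ C such that C = cl(co((C \ S) ∪ E)), one has S^γ ⊆ cl(co(E)) + B̄_γ(0) ⊆ co(E) + B_{2γ}(0). -/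
open Set Metric Bornology Pointwise

variable {X : Type*} [NormedAddCommGroup X] [NormedSpace ℝ X]

theorem sliceSet_subset_sliceSet (f : X →L[ℝ] ℝ) (A : Set X) {δ₁ δ₂ : ℝ} (h : δ₁ ≤ δ₂) :
    sliceSet f A δ₁ ⊆ sliceSet f A δ₂ :=
  fun _ hx ↦ ⟨hx.1, by linarith [hx.2]⟩

theorem bddAbove_image_of_isBounded (f : X →L[ℝ] ℝ) {A : Set X} (hA : IsBounded A) :
    BddAbove (f '' A) :=
  (f.lipschitz.isBounded_image hA).bddAbove

theorem convex_diff_sliceSet (f : X →L[ℝ] ℝ) {A : Set X} (hA : Convex ℝ A) (δ : ℝ) :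
    Convex ℝ (A \ sliceSet f A δ) := by
  have h : A \ sliceSet f A δ = A ∩ {x | f x ≤ sSup (f '' A) - δ} := by
    ext x
    simp only [sliceSet, mem_sdiff, mem_ofPred_eq, mem_inter_iff, not_and, not_lt]
    exact ⟨fun h ↦ ⟨h.1, h.2 h.1⟩, fun h ↦ ⟨h.1, fun _ ↦ h.2⟩⟩
  rw [h]
  exact hA.inter (convex_halfSpace_le f.toLinearMap.isLinear _)

/-- A point of the convex hull of `(C \ S) ∪ E`, where `S` is a slice of a convex subset `C` of the
unit ball, is close to the convex hull of `E` when the functional is close to its supremum there. -/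
theorem exists_mem_convexHull_dist_mul_le {C : Set X} (hC1 : C ⊆ closedBall (0 : X) 1)
    (hCcv : Convex ℝ C) (f : X →L[ℝ] ℝ) {δ : ℝ} (hδ : 0 < δ) {E : Set X} (hEC : E ⊆ C)
    {y : X} (hyC : y ∈ convexHull ℝ ((C \ sliceSet f C δ) ∪ E))
    (hy : sSup (f '' C) - δ < f y) :
    ∃ e ∈ convexHull ℝ E, dist y e * δ ≤ 2 * (sSup (f '' C) - f y) := by
  have hle : ∀ z ∈ C, f z ≤ sSup (f '' C) := fun z hz ↦
    le_csSup (bddAbove_image_of_isBounded f (isBounded_closedBall.subset hC1))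
      (mem_image_of_mem f hz)
  have hdiff : ∀ z ∈ C \ sliceSet f C δ, f z ≤ sSup (f '' C) - δ := fun z hz ↦
    not_lt.1 fun h ↦ hz.2 ⟨hz.1, h⟩
  have hEC' : convexHull ℝ E ⊆ C := convexHull_min hEC hCcv
  rcases (C \ sliceSet f C δ).eq_empty_or_nonempty with h0 | h0
  · rw [h0, empty_union] at hyC
    exact ⟨y, hyC, by rw [dist_self]; linarith [hle y (hEC' hyC)]⟩
  rcases E.eq_empty_or_nonempty with hE | hE
  · rw [hE, union_empty, (convex_diff_sliceSet f hCcv δ).convexHull_eq] at hyC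
    exact absurd hy (not_lt.2 (hdiff y hyC))
  rw [convexHull_union h0 hE, (convex_diff_sliceSet f hCcv δ).convexHull_eq] at hyC
  obtain ⟨a, ha, e, he, s, t, hs, ht, hst, rfl⟩ := mem_convexJoin.1 hyC
  refine ⟨e, he, ?_⟩
  have hae : ‖a - e‖ ≤ 2 := by
    have h1 := mem_closedBall_zero_iff.1 (hC1 ha.1)
    have h2 := mem_closedBall_zero_iff.1 (hC1 (hEC' he))
    linarith [norm_sub_le a e]
  have hdist : dist (s • a + t • e) e ≤ 2 * s := by
    have h : s • a + t • e - e = s • (a - e) := by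
      rw [← eq_sub_iff_add_eq'] at hst
      rw [hst]
      module
    rw [dist_eq_norm, h, norm_smul, Real.norm_of_nonneg hs]
    nlinarith
  have hfy : f (s • a + t • e) ≤ sSup (f '' C) - s * δ := by
    simp only [map_add, map_smul, smul_eq_mul]
    have h1 := mul_le_mul_of_nonneg_left (hdiff a ha) hs
    have h2 := mul_le_mul_of_nonneg_left (hle e (hEC' he)) ht
    have h3 : s * sSup (f '' C) + t * sSup (f '' C) = sSup (f '' C) := by
      rw [← add_mul, hst, one_mul]
    linarith
  linarith [mul_le_mul_of_nonneg_right hdist hδ.le]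

theorem sliceSet_subset_convexHull_add_closedBall {C : Set X} (hC1 : C ⊆ closedBall (0 : X) 1)
    (hCcv : Convex ℝ C) {γ : ℝ} (hγ : γ ≤ 2) (f : X →L[ℝ] ℝ) (hf : ‖f‖ ≤ 1)
    {δ : ℝ} (hδ : 0 < δ) {E : Set X} (hEC : E ⊆ C)
    (hC : C ⊆ closure (convexHull ℝ ((C \ sliceSet f C δ) ∪ E))) :
    sliceSet f C (γ * δ / 2) ⊆ convexHull ℝ E + closedBall (0 : X) γ := by
  rintro x ⟨hxC, hx⟩
  obtain ⟨ε, hε, hε'⟩ : ∃ ε > 0, ε * (δ + 2) = 2 * (f x - (sSup (f '' C) - γ * δ / 2)) :=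
    ⟨2 * (f x - (sSup (f '' C) - γ * δ / 2)) / (δ + 2),
      div_pos (by linarith) (by linarith), div_mul_cancel₀ _ (by linarith)⟩
  obtain ⟨y, hyC, hxy⟩ := mem_closure_iff.1 (hC hxC) ε hε
  have hfxy : f x - f y < ε := by
    rw [← map_sub]
    calc f (x - y) ≤ ‖f (x - y)‖ := Real.le_norm_self _
      _ ≤ 1 * ‖x - y‖ := f.le_of_opNorm_le hf _
      _ < ε := by rwa [one_mul, ← dist_eq_norm]
  have hεδ : 0 < ε * δ := mul_pos hε hδ
  obtain ⟨e, he, hd⟩ := exists_mem_convexHull_dist_mul_le hC1 hCcv f hδ hEC hyC (by nlinarith)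
  refine ⟨e, he, x - e, ?_, add_sub_cancel e x⟩
  rw [mem_closedBall_zero_iff, ← dist_eq_norm]
  have hye : dist y e ≤ γ - ε := le_of_mul_le_mul_right (by linarith) hδ
  linarith [dist_triangle x y e]

theorem closure_add_closedBall_subset_add_ball {V : Type*} [SeminormedAddCommGroup V]
    (A : Set V) {γ : ℝ} (hγ : 0 < γ) :
    closure A + closedBall (0 : V) γ ⊆ A + ball (0 : V) (2 * γ) := by
  rintro _ ⟨e, he, b, hb, rfl⟩
  obtain ⟨e', he', hd⟩ := mem_closure_iff.1 he γ hγ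
  refine ⟨e', he', e - e' + b, ?_, by simp only; abel⟩
  rw [mem_ball_zero_iff]
  rw [mem_closedBall_zero_iff] at hb
  rw [dist_eq_norm] at hd
  linarith [norm_add_le (e - e') b]

theorem statement6 [CompleteSpace X] (C : Set X) (hC1 : C ⊆ Metric.closedBall (0 : X) 1)
    (hCcl : IsClosed C) (hCcv : Convex ℝ C) (hCne : C.Nonempty)
    (γ : ℝ) (hγ : γ ∈ Set.Ioo (0 : ℝ) 1)
    (f : X →L[ℝ] ℝ) (hf : ‖f‖ ≤ 1) (δ : ℝ) (hδ : 0 < δ) :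
    sliceSet f C (γ * δ / 2) ⊆ sliceSet f C δ ∧
    ∀ E ⊆ C, C = closure (convexHull ℝ ((C \ sliceSet f C δ) ∪ E)) →
      sliceSet f C (γ * δ / 2) ⊆ closure (convexHull ℝ E) + Metric.closedBall (0 : X) γ ∧
      closure (convexHull ℝ E) + Metric.closedBall (0 : X) γ ⊆
        convexHull ℝ E + Metric.ball (0 : X) (2 * γ) := by
  obtain ⟨hγ0, hγ1⟩ := hγ
  refine ⟨sliceSet_subset_sliceSet f C (by nlinarith), fun E hEC hC ↦
    ⟨?_, closure_add_closedBall_subset_add_ball _ hγ0⟩⟩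
  exact (sliceSet_subset_convexHull_add_closedBall hC1 hCcv (by linarith) f hf hδ hEC hC.le).trans
    (add_subset_add_right subset_closure)
end

section
/- Let X be a real Banach space, let A ⊆ B_X be nonempty, separable, and non-ε-dentable, and let C = cl(co(A)). Fix δ < ε/2 and write C = ⋃_{i=0}^∞ B_i where each B_i is open relative to C with diam(B_i) < ε. Let (δₙ)ₙ≥₀ be a sequence in (0,1). Then there exist a finitely branching tree 𝕋 ⊆ ℕ^{<ω}, a (2δₙ)ₙ≥₀-approximate bush (x_b)_{b∈𝕋} ⊆ A, and slices (S_b)_{b∈𝕋} of C such that for all n ∈ ℕ: (1) for all b ∈ 𝕋ₙ, x_b ∈ S_b^{δₙ} ∩ A ⊆ S_b; (2) if n ≥ 1, then for all b ∈ 𝕋ₙ, S_b ∩ B_{n−1} = ∅ and S_b ∩ (⋃_{|p| ≤ n−1} B_δ(x_p)) = ∅; (3) if n ≥ 1, then for all b ∈ 𝕋_{n−1} with children (b,1), …, (b,q), one has S_{(b,i)} ⊆ S_b for each i and x_b ∈ co(x_{(b,1)}, …, x_{(b,q)}) + B_{2δ_{n−1}}(0). -/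
open Set Metric Bornology Pointwise

variable {X : Type*} [NormedAddCommGroup X] [NormedSpace ℝ X]

/-- A tree: a nonempty set of finite sequences of naturals closed under dropping
the last entry. -/
def IsTree (T : Set (List ℕ)) : Prop :=
  T.Nonempty ∧ ∀ (b : List ℕ) (i : ℕ), b ++ [i] ∈ T → b ∈ T

/-- A tree is finitely branching if every node has finitely many children. -/
def FinitelyBranching (T : Set (List ℕ)) : Prop :=
  ∀ b ∈ T, {i : ℕ | b ++ [i] ∈ T}.Finite

lemma le_of_mem_closure_convexHull {f : X →L[ℝ] ℝ} {K : Set X} {m : ℝ}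
    (h : ∀ k ∈ K, f k ≤ m) {x : X} (hx : x ∈ closure (convexHull ℝ K)) : f x ≤ m := by
  have hconv : Convex ℝ {y : X | f y ≤ m} := convex_halfSpace_le f.isLinear m
  have hclosed : IsClosed {y : X | f y ≤ m} := isClosed_le f.continuous continuous_const
  exact closure_minimal (convexHull_min h hconv) hclosed hx

lemma bddAbove_image_of_subset_closedBall (f : X →L[ℝ] ℝ) {C : Set X}
    (hC : C ⊆ closedBall (0 : X) 1) : BddAbove (f '' C) := by
  refine ⟨‖f‖, ?_⟩
  rintro _ ⟨c, hc, rfl⟩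
  have h1 : ‖c‖ ≤ 1 := by simpa using hC hc
  calc f c ≤ ‖f c‖ := le_abs_self _
    _ ≤ ‖f‖ * ‖c‖ := f.le_opNorm c
    _ ≤ ‖f‖ := mul_le_of_le_one_right (norm_nonneg _) h1

lemma le_sSup_image {f : X →L[ℝ] ℝ} {C : Set X} (hC : C ⊆ closedBall (0 : X) 1) {c : X}
    (hc : c ∈ C) : f c ≤ sSup (f '' C) :=
  le_csSup (bddAbove_image_of_subset_closedBall f hC) (mem_image_of_mem f hc)

lemma sliceSet_mono {f : X →L[ℝ] ℝ} {C : Set X} {α β : ℝ} (h : α ≤ β) :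
    sliceSet f C α ⊆ sliceSet f C β :=
  fun _ hx => ⟨hx.1, by linarith [hx.2]⟩

lemma sliceSet_nonempty {f : X →L[ℝ] ℝ} {C : Set X} {β : ℝ} (hC : C.Nonempty) (hβ : 0 < β) :
    (sliceSet f C β).Nonempty := by
  obtain ⟨_, ⟨c, hc, rfl⟩, h⟩ := exists_lt_of_lt_csSup (hC.image f) (sub_lt_self (sSup (f '' C)) hβ)
  exact ⟨c, hc, h⟩

/-- A generating set meets every slice of its closed convex hull. -/
lemma exists_mem_sliceSet_closure_convexHull {A : Set X} (hA : A.Nonempty) (f : X →L[ℝ] ℝ)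
    {β : ℝ} (hβ : 0 < β) : ∃ a ∈ A, a ∈ sliceSet f (closure (convexHull ℝ A)) β := by
  by_contra! h
  obtain ⟨c, hc, hlt⟩ := sliceSet_nonempty (f := f) (C := closure (convexHull ℝ A))
    hA.convexHull.closure hβ
  refine absurd hlt (not_lt.2 (le_of_mem_closure_convexHull (fun a ha => ?_) hc))
  exact not_lt.1 fun hlt => h a ha ⟨subset_closure (subset_convexHull ℝ A ha), hlt⟩

/-- Slices of the closed convex hull of a non-`ε`-dentable set have diameter larger than `ε`. -/
lemma lt_diam_sliceSet_closure_convexHull {A : Set X} {ε : ℝ} (hA : A.Nonempty)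
    (hAnd : ¬ EpsDentable ε A) (hC : closure (convexHull ℝ A) ⊆ closedBall (0 : X) 1)
    {f : X →L[ℝ] ℝ} (hf : ‖f‖ ≤ 1) {β : ℝ} (hβ : 0 < β) :
    ε < diam (sliceSet f (closure (convexHull ℝ A)) β) := by
  by_contra! h
  refine hAnd ⟨_, ⟨f, β, hf, hβ, rfl⟩, le_trans (diam_mono ?_ ?_) h⟩
  · have hAC : A ⊆ closure (convexHull ℝ A) := (subset_convexHull ℝ A).trans subset_closure
    have hsup : sSup (f '' closure (convexHull ℝ A)) ≤ sSup (f '' A) := by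
      refine csSup_le (hA.convexHull.closure.image f) ?_
      rintro _ ⟨c, hc, rfl⟩
      exact le_of_mem_closure_convexHull (fun a ha => le_sSup_image (hAC.trans hC) ha) hc
    exact fun a ha => ⟨hAC ha.1, by linarith [ha.2]⟩
  · exact isBounded_closedBall.subset ((sep_subset _ _).trans hC)

lemma exists_dual_le_sSup_sub {C K : Set X} (hC : C ⊆ closedBall (0 : X) 1) {c : X} (hc : c ∈ C)
    (hcK : c ∉ closure (convexHull ℝ K)) :
    ∃ (f : X →L[ℝ] ℝ) (a : ℝ), ‖f‖ ≤ 1 ∧ 0 < a ∧ ∀ k ∈ K, f k ≤ sSup (f '' C) - a := by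
  obtain ⟨g, u, hgu, huc⟩ := geometric_hahn_banach_closed_point
    (convex_convexHull ℝ K).closure isClosed_closure hcK
  have hpos : 0 < (1 + ‖g‖)⁻¹ := by positivity
  refine ⟨(1 + ‖g‖)⁻¹ • g, (1 + ‖g‖)⁻¹ * (g c - u), ?_, mul_pos hpos (sub_pos.2 huc),
    fun k hk => ?_⟩
  · rw [norm_smul, Real.norm_of_nonneg hpos.le, inv_mul_le_iff₀ (by positivity)]
    linarith
  · have h1 := hgu k (subset_closure (subset_convexHull ℝ K hk))
    have h2 := le_sSup_image (f := (1 + ‖g‖)⁻¹ • g) hC hc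
    have h3 := mul_lt_mul_of_pos_left h1 hpos
    simp only [_root_.smul_apply, smul_eq_mul] at h2 ⊢
    linarith

/-- If `J₀` lies at depth `a` below level `M` of `f`, points of the closed convex hull of `J₀ ∪ J₁`
that are within `t * a` of level `M` are `4 * t`-close to `J₁`. -/
lemma exists_norm_sub_lt_of_near_level {J₀ J₁ : Set X} {f : X →L[ℝ] ℝ} {M a t : ℝ} {x : X}
    (h₀ : Convex ℝ J₀) (h₁ : Convex ℝ J₁) (hb₀ : J₀ ⊆ closedBall (0 : X) 1)
    (hb₁ : J₁ ⊆ closedBall (0 : X) 1) (hf : ‖f‖ ≤ 1) (ha : 0 < a) (ht : 0 < t) (ht1 : t ≤ 1)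
    (hM₀ : ∀ y ∈ J₀, f y ≤ M - a) (hM₁ : ∀ z ∈ J₁, f z ≤ M)
    (hx : x ∈ closure (convexHull ℝ (J₀ ∪ J₁))) (hfx : M - t * a < f x) :
    ∃ e ∈ J₁, ‖x - e‖ < 4 * t := by
  obtain ⟨w, hw, hxw⟩ := Metric.mem_closure_iff.1 hx (min t (f x - (M - t * a)))
    (lt_min ht (sub_pos.2 hfx))
  rw [dist_eq_norm, lt_min_iff] at hxw
  have hfw : M - t * a < f w := by
    have h : f (x - w) ≤ ‖x - w‖ :=
      (le_abs_self _).trans ((f.le_opNorm _).trans (mul_le_of_le_one_left (norm_nonneg _) hf))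
    rw [map_sub] at h
    linarith [hxw.2]
  rcases J₁.eq_empty_or_nonempty with rfl | hne₁
  · rw [union_empty, h₀.convexHull_eq] at hw
    nlinarith [hM₀ w hw]
  rcases J₀.eq_empty_or_nonempty with rfl | hne₀
  · rw [empty_union, h₁.convexHull_eq] at hw
    exact ⟨w, hw, by linarith [hxw.1]⟩
  rw [h₀.convexHull_union h₁ hne₀ hne₁, mem_convexJoin] at hw
  obtain ⟨y, hy, z, hz, p, q, hp, hq, hpq, rfl⟩ := hw
  refine ⟨z, hz, ?_⟩
  have hpt : p < t := by
    simp only [map_add, map_smul, smul_eq_mul] at hfw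
    have h1 := mul_le_mul_of_nonneg_left (hM₀ y hy) hp
    have h2 := mul_le_mul_of_nonneg_left (hM₁ z hz) hq
    obtain rfl : q = 1 - p := by linarith
    nlinarith
  have hyz : ‖y - z‖ ≤ 2 := by
    have h1 : ‖y‖ ≤ 1 := by simpa using hb₀ hy
    have h2 : ‖z‖ ≤ 1 := by simpa using hb₁ hz
    linarith [norm_sub_le y z]
  have hsplit : x - z = (x - (p • y + q • z)) + p • (y - z) := by
    obtain rfl : q = 1 - p := by linarith
    module
  have hsmul : ‖p • (y - z)‖ ≤ p * 2 := by
    rw [norm_smul, Real.norm_of_nonneg hp]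
    exact mul_le_mul_of_nonneg_left hyz hp
  rw [hsplit]
  linarith [norm_add_le (x - (p • y + q • z)) (p • (y - z)), hxw.1]

/-- If all slices of `C` have diameter larger than `ε`, then a set of diameter less than `ε` can be
dropped from any set generating `C`. -/
lemma subset_closure_convexHull_of_union {C K D : Set X} {ε : ℝ} (hC : C ⊆ closedBall (0 : X) 1)
    (hslice : ∀ f : X →L[ℝ] ℝ, ‖f‖ ≤ 1 → ∀ β > 0, ε < diam (sliceSet f C β))
    (hK : K ⊆ C) (hD : D ⊆ C) (hdiam : diam D < ε)
    (hgen : C ⊆ closure (convexHull ℝ (K ∪ D))) : C ⊆ closure (convexHull ℝ K) := by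
  by_contra hnot
  obtain ⟨c, hc, hcK⟩ := not_subset.1 hnot
  obtain ⟨f, a, hf, ha, hfK⟩ := exists_dual_le_sSup_sub hC hc hcK
  obtain ⟨t, ht, ht1, hte⟩ : ∃ t : ℝ, 0 < t ∧ t ≤ 1 ∧ diam D + 8 * t ≤ ε :=
    ⟨min 1 ((ε - diam D) / 8), lt_min one_pos (by linarith), min_le_left _ _, by
      linarith [min_le_right 1 ((ε - diam D) / 8)]⟩
  have hball : ∀ {E : Set X}, E ⊆ C → convexHull ℝ E ⊆ closedBall (0 : X) 1 := fun hE =>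
    convexHull_min (hE.trans hC) (convex_closedBall 0 1)
  have hnear : ∀ x ∈ sliceSet f C (t * a), ∃ e ∈ convexHull ℝ D, ‖x - e‖ < 4 * t := by
    intro x hx
    refine exists_norm_sub_lt_of_near_level (convex_convexHull ℝ K) (convex_convexHull ℝ D)
      (hball hK) (hball hD) hf ha ht ht1
      (fun y hy => le_of_mem_closure_convexHull hfK (subset_closure hy))
      (fun z hz => le_of_mem_closure_convexHull (fun d hd => le_sSup_image hC (hD hd))
        (subset_closure hz)) ?_ hx.2
    exact closure_mono (convexHull_mono (union_subset_union (subset_convexHull ℝ K)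
      (subset_convexHull ℝ D))) (hgen hx.1)
  have hDb : IsBounded (convexHull ℝ D) := isBounded_closedBall.subset (hball hD)
  refine absurd (hslice f hf (t * a) (mul_pos ht ha))
    (not_lt.2 (diam_le_of_forall_dist_le (by linarith [diam_nonneg (s := D)]) ?_))
  intro x hx y hy
  obtain ⟨d, hd, hxd⟩ := hnear x hx
  obtain ⟨e, he, hye⟩ := hnear y hy
  have hde := dist_le_diam_of_mem hDb hd he
  rw [convexHull_diam] at hde
  rw [← dist_eq_norm] at hxd hye
  linarith [dist_triangle4_right x y d e]

lemma subset_closure_convexHull_of_union_sUnion {C K : Set X} {ε : ℝ}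
    (hC : C ⊆ closedBall (0 : X) 1)
    (hslice : ∀ f : X →L[ℝ] ℝ, ‖f‖ ≤ 1 → ∀ β > 0, ε < diam (sliceSet f C β))
    (hK : K ⊆ C) {𝒟 : Set (Set X)} (hfin : 𝒟.Finite) (h𝒟 : ∀ D ∈ 𝒟, D ⊆ C ∧ diam D < ε)
    (hgen : C ⊆ closure (convexHull ℝ (K ∪ ⋃₀ 𝒟))) : C ⊆ closure (convexHull ℝ K) := by
  induction 𝒟, hfin using Set.Finite.induction_on with
  | empty => simpa using hgen
  | @insert D 𝒟 _ _ ih =>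
    have h𝒟' : ∀ D' ∈ 𝒟, D' ⊆ C ∧ diam D' < ε := fun D' hD' => h𝒟 D' (mem_insert_of_mem D hD')
    refine ih h𝒟' (subset_closure_convexHull_of_union hC hslice
      (union_subset hK (sUnion_subset fun D' hD' => (h𝒟' D' hD').1))
      (h𝒟 D (mem_insert D 𝒟)).1 (h𝒟 D (mem_insert D 𝒟)).2 ?_)
    rwa [sUnion_insert, union_comm D, ← union_assoc] at hgen

/-- A point of a shallow slice of `C` is almost a convex combination of points of `A` lying in
shallow parallels of smaller slices that avoid finitely many given sets of small diameter. -/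
lemma exists_list_slices {A C : Set X} {ε : ℝ} (hAne : A.Nonempty)
    (hCA : C = closure (convexHull ℝ A)) (hC : C ⊆ closedBall (0 : X) 1)
    (hslice : ∀ f : X →L[ℝ] ℝ, ‖f‖ ≤ 1 → ∀ β > 0, ε < diam (sliceSet f C β))
    {𝒟 : Set (Set X)} (hfin : 𝒟.Finite) (h𝒟 : ∀ D ∈ 𝒟, D ⊆ C ∧ diam D < ε)
    {f : X →L[ℝ] ℝ} {α γ γ' : ℝ} (hf : ‖f‖ ≤ 1) (hα : 0 < α) (hγ : γ ∈ Ioo (0 : ℝ) 1)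
    (hγ' : γ' ∈ Ioo (0 : ℝ) 1) {x : X} (hx : x ∈ sliceSet f C (γ * α / 2)) :
    ∃ L : List (X × (X →L[ℝ] ℝ) × ℝ),
      (∀ q ∈ L, (‖q.2.1‖ ≤ 1 ∧ 0 < q.2.2 ∧ q.1 ∈ sliceSet q.2.1 C (γ' * q.2.2 / 2) ∩ A) ∧
        sliceSet q.2.1 C q.2.2 ⊆ sliceSet f C α ∧
        ∀ D ∈ 𝒟, Disjoint (sliceSet q.2.1 C q.2.2) D) ∧
      x ∈ convexHull ℝ {z | ∃ q ∈ L, z = q.1} + ball (0 : X) (2 * γ) := by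
  set E : Set X := {y | ∃ r : (X →L[ℝ] ℝ) × ℝ,
    (‖r.1‖ ≤ 1 ∧ 0 < r.2 ∧ y ∈ sliceSet r.1 C (γ' * r.2 / 2) ∩ A) ∧
      sliceSet r.1 C r.2 ⊆ sliceSet f C α ∧ ∀ D ∈ 𝒟, Disjoint (sliceSet r.1 C r.2) D} with hE
  set J : Set X := {c ∈ C | f c ≤ sSup (f '' C) - α} with hJ
  have hEC : E ⊆ C := fun y ⟨r, h, _⟩ => h.2.2.1.1
  have hCconv : Convex ℝ C := hCA ▸ (convex_convexHull ℝ A).closure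
  have hJconv : Convex ℝ J := hCconv.inter (convex_halfSpace_le f.isLinear _)
  have hgen : C ⊆ closure (convexHull ℝ ((J ∪ E) ∪ ⋃₀ 𝒟)) := by
    by_contra hnot
    obtain ⟨c, hc, hcK⟩ := not_subset.1 hnot
    obtain ⟨g, β, hg, hβ, hgK⟩ := exists_dual_le_sSup_sub hC hc hcK
    have hγβ : γ' * β / 2 ≤ β := by nlinarith [hγ'.2]
    obtain ⟨y, hyA, hy⟩ := exists_mem_sliceSet_closure_convexHull hAne g
      (show 0 < γ' * β / 2 by have := hγ'.1; positivity)
    rw [← hCA] at hy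
    refine absurd (sliceSet_mono hγβ hy).2 (not_lt.2 (hgK y (Or.inl (Or.inr
      ⟨(g, β), ⟨hg, hβ, hy, hyA⟩, fun z hz => ⟨hz.1, ?_⟩, fun D hD => ?_⟩))))
    · by_contra hle
      exact absurd hz.2 (not_lt.2 (hgK z (Or.inl (Or.inl ⟨hz.1, not_lt.1 hle⟩))))
    · exact disjoint_left.2 fun z hz hzD =>
        absurd hz.2 (not_lt.2 (hgK z (Or.inr ⟨D, hD, hzD⟩)))
  have hgen' := subset_closure_convexHull_of_union_sUnion hC hslice
    (union_subset (sep_subset _ _) hEC) hfin h𝒟 hgen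
  obtain ⟨e, he, hxe⟩ := exists_norm_sub_lt_of_near_level (x := x) (M := sSup (f '' C))
    (t := γ / 2) hJconv
    (convex_convexHull ℝ E) ((sep_subset _ _).trans hC)
    (convexHull_min (hEC.trans hC) (convex_closedBall 0 1)) hf hα (by linarith [hγ.1])
    (by linarith [hγ.2]) (fun y hy => hy.2)
    (fun z hz => le_of_mem_closure_convexHull (fun y hy => le_sSup_image hC (hEC hy))
      (subset_closure hz))
    (closure_mono (convexHull_mono (union_subset_union_right J (subset_convexHull ℝ E)))
      (hgen' hx.1)) (by linarith [hx.2])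
  rw [convexHull_eq_union_convexHull_finite_subsets] at he
  simp only [mem_iUnion] at he
  obtain ⟨s, hsE, hes⟩ := he
  choose! r hr using fun y (hy : y ∈ E) => hy
  refine ⟨s.toList.map fun y => (y, r y), ?_, e, ?_, x - e, ?_, by simp⟩
  · intro q hq
    obtain ⟨y, hy, rfl⟩ := List.mem_map.1 hq
    exact hr y (hsE (Finset.mem_toList.1 hy))
  · refine convexHull_mono (fun y hy => ?_) hes
    exact ⟨(y, r y), List.mem_map.2 ⟨y, Finset.mem_toList.2 hy, rfl⟩, rfl⟩
  · rw [mem_ball_zero_iff]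
    linarith

/-- Level-by-level construction of a labelled tree: the first component labels the nodes of a
level, the second collects the labels used so far. The children of a node with label `p` on level
`n` are labelled by the list `ch n s p`, where `s` is the set of labels used up to level `n`. -/
def labelLevel {P : Type*} (p₀ : P) (ch : ℕ → Set P → P → List P) :
    ℕ → (List ℕ → Option P) × Set P
  | 0 => (fun b => if b = [] then some p₀ else none, {p₀})
  | n + 1 =>
    let prev := labelLevel p₀ ch n
    let next : List ℕ → Option P := fun c =>
      c.getLast?.bind fun i => (prev.1 c.dropLast).bind fun p => (ch n prev.2 p)[i]?
    (next, prev.2 ∪ {p | ∃ b, next b = some p})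

section labelLevel

variable {P : Type*} {p₀ : P} {ch : ℕ → Set P → P → List P}

lemma labelLevel_succ_append (n : ℕ) (b : List ℕ) (i : ℕ) :
    (labelLevel p₀ ch (n + 1)).1 (b ++ [i]) =
      ((labelLevel p₀ ch n).1 b).bind fun p => (ch n (labelLevel p₀ ch n).2 p)[i]? := by
  simp [labelLevel]

lemma exists_of_labelLevel_succ_eq_some {n : ℕ} {c : List ℕ} {q : P}
    (h : (labelLevel p₀ ch (n + 1)).1 c = some q) :
    ∃ b i p, c = b ++ [i] ∧ (labelLevel p₀ ch n).1 b = some p ∧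
      (ch n (labelLevel p₀ ch n).2 p)[i]? = some q := by
  rcases List.eq_nil_or_concat' c with rfl | ⟨b, i, rfl⟩
  · simp [labelLevel] at h
  · rw [labelLevel_succ_append, Option.bind_eq_some_iff] at h
    obtain ⟨p, hp, hq⟩ := h
    exact ⟨b, i, p, rfl, hp, hq⟩

lemma mem_labelLevel_snd {m n : ℕ} (hmn : m ≤ n) {b : List ℕ} {p : P}
    (h : (labelLevel p₀ ch m).1 b = some p) : p ∈ (labelLevel p₀ ch n).2 := by
  induction n, hmn using Nat.le_induction with
  | base =>
    cases m with
    | zero =>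
      have h' := h
      simp only [labelLevel, Option.ite_none_right_eq_some, Option.some.injEq] at h' ⊢
      exact h'.2.symm
    | succ m => exact Or.inr ⟨b, h⟩
  | succ n _ ih => exact Or.inl ih

lemma finite_labelLevel (n : ℕ) :
    {b | ∃ p, (labelLevel p₀ ch n).1 b = some p}.Finite ∧ (labelLevel p₀ ch n).2.Finite := by
  induction n with
  | zero =>
    refine ⟨(finite_singleton ([] : List ℕ)).subset ?_, finite_singleton p₀⟩
    rintro b ⟨p, hp⟩
    simp only [labelLevel, Option.ite_none_right_eq_some] at hp
    exact hp.1
  | succ n ih =>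
    have hdom : {c | ∃ q, (labelLevel p₀ ch (n + 1)).1 c = some q}.Finite := by
      refine (ih.1.biUnion fun b _ => (ih.2.biUnion fun p _ =>
        (finite_lt_nat (ch n (labelLevel p₀ ch n).2 p).length).image
          fun i => b ++ [i])).subset ?_
      rintro c ⟨q, hq⟩
      obtain ⟨b, i, p, rfl, hp, hi⟩ := exists_of_labelLevel_succ_eq_some hq
      obtain ⟨hlt, _⟩ := List.getElem?_eq_some_iff.1 hi
      exact mem_biUnion (show b ∈ {b | ∃ p, (labelLevel p₀ ch n).1 b = some p} from ⟨p, hp⟩)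
        (mem_biUnion (mem_labelLevel_snd le_rfl hp) ⟨i, hlt, rfl⟩)
    refine ⟨hdom, ih.2.union (((hdom.image (labelLevel p₀ ch (n + 1)).1).preimage
      (Option.some_injective P).injOn).subset ?_)⟩
    rintro p ⟨b, hb⟩
    exact ⟨b, ⟨p, hb⟩, hb⟩

end labelLevel

theorem statement8 [CompleteSpace X] (A : Set X)
    (hA1 : A ⊆ Metric.closedBall (0 : X) 1) (hAne : A.Nonempty)
    (hAsep : TopologicalSpace.IsSeparable A)
    (ε : ℝ) (hε : 0 < ε) (hAnd : ¬ EpsDentable ε A)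
    (C : Set X) (hC : C = closure (convexHull ℝ A))
    (δ : ℝ) (hδ : δ < ε / 2)
    -- `C = ⋃ᵢ Bᵢ` with each `Bᵢ` open relative to `C` of diameter `< ε`
    (B : ℕ → Set X) (hBopen : ∀ i, ∃ U : Set X, IsOpen U ∧ B i = U ∩ C)
    (hBdiam : ∀ i, Metric.diam (B i) < ε) (hBcover : C = ⋃ i, B i)
    (δseq : ℕ → ℝ) (hδseq : ∀ n, δseq n ∈ Set.Ioo (0 : ℝ) 1) :
    ∃ (T : Set (List ℕ)) (x : List ℕ → X)
      (f : List ℕ → X →L[ℝ] ℝ) (α : List ℕ → ℝ),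
      IsTree T ∧ FinitelyBranching T ∧
      -- the `S_b := sliceSet (f b) C (α b)` are slices of `C`
      (∀ b ∈ T, ‖f b‖ ≤ 1 ∧ 0 < α b) ∧
      -- (1) `x_b ∈ S_b^{δ_n} ∩ A ⊆ S_b` for `b` of length `n`
      (∀ b ∈ T, x b ∈ sliceSet (f b) C (δseq b.length * α b / 2) ∩ A) ∧
      (∀ b ∈ T, sliceSet (f b) C (δseq b.length * α b / 2) ∩ A ⊆
        sliceSet (f b) C (α b)) ∧
      -- (2) for `b` of length `n ≥ 1`, `S_b` misses `B_{n-1}` and all balls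
      -- `B_δ(x_p)` with `|p| ≤ n - 1`
      (∀ b ∈ T, 1 ≤ b.length →
        sliceSet (f b) C (α b) ∩ B (b.length - 1) = ∅ ∧
        ∀ p ∈ T, p.length ≤ b.length - 1 →
          sliceSet (f b) C (α b) ∩ Metric.ball (x p) δ = ∅) ∧
      -- (3) slices of children are contained in the slice of the parent
      (∀ b ∈ T, ∀ i : ℕ, b ++ [i] ∈ T →
        sliceSet (f (b ++ [i])) C (α (b ++ [i])) ⊆ sliceSet (f b) C (α b)) ∧
      -- (x_b) is a (2δₙ)-approximate bush contained in A
      (∀ b ∈ T, x b ∈ convexHull ℝ {z | ∃ i : ℕ, b ++ [i] ∈ T ∧ z = x (b ++ [i])}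
        + Metric.ball (0 : X) (2 * δseq b.length)) := by
  have hCb : C ⊆ closedBall (0 : X) 1 :=
    hC ▸ closure_minimal (convexHull_min hA1 (convex_closedBall 0 1)) isClosed_closedBall
  have hAC : A ⊆ C := hC ▸ (subset_convexHull ℝ A).trans subset_closure
  have hslice : ∀ g : X →L[ℝ] ℝ, ‖g‖ ≤ 1 → ∀ β > 0, ε < diam (sliceSet g C β) := by
    subst hC
    exact fun g hg β hβ => lt_diam_sliceSet_closure_convexHull hAne hAnd hCb hg hβ
  let P := X × (X →L[ℝ] ℝ) × ℝ
  let Good : ℕ → P → Prop := fun n q =>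
    ‖q.2.1‖ ≤ 1 ∧ 0 < q.2.2 ∧ q.1 ∈ sliceSet q.2.1 C (δseq n * q.2.2 / 2) ∩ A
  have hball : ∀ y : X, diam (ball y δ ∩ C) < ε := by
    intro y
    rcases le_or_gt 0 δ with h0 | h0
    · linarith [diam_mono (inter_subset_left (s := ball y δ) (t := C)) isBounded_ball,
        diam_ball (x := y) h0]
    · simpa [ball_eq_empty.2 h0.le] using hε
  have hstep : ∀ (n : ℕ) (s : Set P) (p : P), ∃ L : List P, s.Finite → Good n p →
      (∀ q ∈ L, Good (n + 1) q ∧ sliceSet q.2.1 C q.2.2 ⊆ sliceSet p.2.1 C p.2.2 ∧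
        sliceSet q.2.1 C q.2.2 ∩ B n = ∅ ∧
        ∀ r ∈ s, sliceSet q.2.1 C q.2.2 ∩ ball r.1 δ = ∅) ∧
      p.1 ∈ convexHull ℝ {z | ∃ q ∈ L, z = q.1} + ball (0 : X) (2 * δseq n) := by
    intro n s p
    by_cases hs : s.Finite ∧ Good n p
    swap
    · exact ⟨[], fun h1 h2 => absurd ⟨h1, h2⟩ hs⟩
    obtain ⟨hs, hp⟩ := hs
    obtain ⟨L, hL, hconv⟩ := exists_list_slices hAne hC hCb hslice
      (𝒟 := insert (B n) ((fun r : P => ball r.1 δ ∩ C) '' s)) ((hs.image _).insert _)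
      (by
        rintro D (rfl | ⟨r, -, rfl⟩)
        · exact ⟨hBcover ▸ subset_iUnion B n, hBdiam n⟩
        · exact ⟨inter_subset_right, hball r.1⟩)
      hp.1 hp.2.1 (hδseq n) (hδseq (n + 1)) hp.2.2.1
    refine ⟨L, fun _ _ => ⟨fun q hq => ?_, hconv⟩⟩
    obtain ⟨h1, h2, h3⟩ := hL q hq
    refine ⟨h1, h2, disjoint_iff_inter_eq_empty.1 (h3 _ (mem_insert _ _)), fun r hr => ?_⟩
    have hdisj := disjoint_left.1 (h3 _ (mem_insert_of_mem _ ⟨r, hr, rfl⟩))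
    exact disjoint_iff_inter_eq_empty.1 (disjoint_left.2 fun z hz hzr => hdisj hz ⟨hzr, hz.1⟩)
  choose ch hch using hstep
  obtain ⟨x₀, hx₀⟩ := hAne
  let p₀ : P := (x₀, 0, 1)
  let lab : ℕ → List ℕ → Option P := fun n => (labelLevel p₀ ch n).1
  have hgood : ∀ n b p, lab n b = some p → Good n p := by
    intro n
    induction n with
    | zero =>
      intro b p hp
      simp only [lab, labelLevel, Option.ite_none_right_eq_some, Option.some.injEq] at hp
      obtain ⟨-, rfl⟩ := hp
      refine ⟨by simp [p₀], by simp [p₀], ⟨hAC hx₀, ?_⟩, hx₀⟩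
      have himg : (fun _ : X => (0 : ℝ)) '' C = {0} := Set.Nonempty.image_const ⟨x₀, hAC hx₀⟩ 0
      simp [p₀, himg, (hδseq 0).1]
    | succ n ih =>
      intro c q hq
      obtain ⟨b, i, p, rfl, hp, hi⟩ := exists_of_labelLevel_succ_eq_some hq
      exact ((hch n _ p (finite_labelLevel n).2 (ih b p hp)).1 q (List.mem_of_getElem? hi)).1
  let lbl : List ℕ → P := fun b => (lab b.length b).getD p₀
  let T : Set (List ℕ) := {b | ∃ p, lab b.length b = some p}
  have hlbl : ∀ {b p}, lab b.length b = some p → lbl b = p := fun h => by simp [lbl, h]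
  have hT : ∀ b ∈ T, Good b.length (lbl b) := by
    rintro b ⟨p, hp⟩
    rw [hlbl hp]
    exact hgood _ b p hp
  have hchild : ∀ b i, b ++ [i] ∈ T → b ∈ T ∧
      lbl (b ++ [i]) ∈ ch b.length (labelLevel p₀ ch b.length).2 (lbl b) := by
    rintro b i ⟨q, hq⟩
    have hq' := hq
    simp only [lab, List.length_append, List.length_singleton, labelLevel_succ_append,
      Option.bind_eq_some_iff] at hq'
    obtain ⟨p, hp, hi⟩ := hq'
    exact ⟨⟨p, hp⟩, by rw [hlbl hq, hlbl hp]; exact List.mem_of_getElem? hi⟩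
  have hspec : ∀ b ∈ T, _ := fun b hb =>
    hch b.length _ (lbl b) (finite_labelLevel (p₀ := p₀) (ch := ch) b.length).2 (hT b hb)
  refine ⟨T, fun b => (lbl b).1, fun b => (lbl b).2.1, fun b => (lbl b).2.2,
    ⟨⟨[], p₀, by simp [lab, labelLevel]⟩, fun b i h => (hchild b i h).1⟩, ?_,
    fun b hb => ⟨(hT b hb).1, (hT b hb).2.1⟩, fun b hb => (hT b hb).2.2, ?_, ?_, ?_, ?_⟩
  · intro b _
    refine ((finite_labelLevel (p₀ := p₀) (ch := ch) (b.length + 1)).1.preimage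
      (f := fun i : ℕ => b ++ [i]) (fun i _ j _ h => by simpa using h)).subset ?_
    rintro i ⟨q, hq⟩
    exact ⟨q, by simpa [lab] using hq⟩
  · intro b hb
    refine inter_subset_left.trans (sliceSet_mono ?_)
    nlinarith [(hδseq b.length).2, (hT b hb).2.1]
  · intro c hc hlen
    rcases List.eq_nil_or_concat' c with rfl | ⟨b, i, rfl⟩
    · simp at hlen
    obtain ⟨hb, hmem⟩ := hchild b i hc
    obtain ⟨-, -, h1, h2⟩ := (hspec b hb).1 _ hmem
    simp only [List.length_append, List.length_singleton, Nat.add_sub_cancel]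
    refine ⟨h1, ?_⟩
    rintro d ⟨p, hp⟩ hd
    have hmem' := mem_labelLevel_snd hd hp
    simpa only [hlbl hp] using h2 p hmem'
  · intro b hb i hi
    exact ((hspec b hb).1 _ (hchild b i hi).2).2.1
  · intro b hb
    refine add_subset_add_right (convexHull_mono ?_) (hspec b hb).2
    rintro z ⟨q, hq, rfl⟩
    obtain ⟨i, hi⟩ := List.mem_iff_getElem?.1 hq
    obtain ⟨p, hp⟩ := hb
    have hq' : lab (b ++ [i]).length (b ++ [i]) = some q := by
      simp only [lab, List.length_append, List.length_singleton, labelLevel_succ_append,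
        Option.bind_eq_some_iff]
      exact ⟨p, hp, by rwa [hlbl hp] at hi⟩
    exact ⟨i, ⟨q, hq'⟩, (congrArg Prod.fst (hlbl hq')).symm⟩
end
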